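/- In a finite rooted tree T where each node is labeled either 'inlinable' or 'non-inlinable' (with the root labeled non-inlinable), consider the BFS-style process: a queue q initially contains the root; whenever a non-inlinable node e is dequeued from q, all children of e are enqueued into an auxiliary queue r; whenever a node f is dequeued from r, if f is non-inlinable it is enqueued into q, and if f is inlinable all children of f are enqueued into r. Then every non-inlinable node of T is enqueued into q exactly once, and q only ever contains non-inlinable nodes. -/

import Mathlib

/-- A finite rooted tree with Boolean inlinability labels; the root is non-inlinable.
    Acyclicity is enforced by a depth function. -/
structure RTree (V : Type) [Fintype V] [DecidableEq V] where
  root : V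
  parent : V → Option V
  inlinable : V → Bool
  root_parent : parent root = none
  parent_of_ne : ∀ v, v ≠ root → (parent v).isSome
  depth : V → ℕ
  depth_root : depth root = 0
  depth_parent : ∀ v p, parent v = some p → depth v = depth p + 1
  root_not_inlinable : inlinable root = false

namespace RTree

/-- Events of the two-queue traversal. -/
inductive Event (V : Type) where
  | deqQ : V → Event V
  | deqR : V → Event V
  | enqQ : V → Event V
  | enqR : V → Event V
  deriving DecidableEq

variable {V : Type} [Fintype V] [DecidableEq V] (T : RTree V)

/-- The children of a node, as a list. -/
noncomputable def children (v : V) : List V :=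
  (Finset.univ.filter (fun w => T.parent w = some v)).toList

/-- One run of the two-queue traversal with the given fuel, starting from the state
    `(q, r)`.  Dequeues from the auxiliary queue `r` take priority (the inner loop);
    dequeuing an inlinable node from `r` enqueues its children into `r`, dequeuing a
    non-inlinable node from `r` enqueues it into `q`; when `r` is empty, a node is
    dequeued from `q` and its children are enqueued into `r`.  Returns the event
    trace together with the final state. -/
noncomputable def run (T : RTree V) : ℕ → List V × List V → List (Event V) × (List V × List V)
  | 0, s => ([], s)
  | fuel+1, (q, f :: r) =>
      if T.inlinable f then
        let res := run T fuel (q, r ++ T.children f)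
        (Event.deqR f :: ((T.children f).map Event.enqR ++ res.1), res.2)
      else
        let res := run T fuel (q ++ [f], r)
        (Event.deqR f :: Event.enqQ f :: res.1, res.2)
  | fuel+1, (e :: q, []) =>
      let res := run T fuel (q, T.children e)
      (Event.deqQ e :: ((T.children e).map Event.enqR ++ res.1), res.2)
  | _+1, ([], []) => ([], ([], []))

/-- `a` is a (proper-or-self) ancestor of `v` after `k` parent steps. -/
def parentIter (T : RTree V) : ℕ → V → Option V
  | 0, v => some v
  | k+1, v => (T.parent v).bind (parentIter T k)

/-- `a` is a strict ancestor of `v`. -/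
def StrictAncestor (a v : V) : Prop := ∃ k, 1 ≤ k ∧ T.parentIter k v = some a

end RTree


namespace RTree

/-- Whether an event is a dequeue from the main queue `q`. -/
def Event.isDeqQ {V : Type} : Event V → Bool
  | .deqQ _ => true
  | _ => false

/-- Whether an event is a dequeue from the auxiliary queue `r`. -/
def Event.isDeqR {V : Type} : Event V → Bool
  | .deqR _ => true
  | _ => false

/-- Whether an event is an enqueue into the auxiliary queue `r`. -/
def Event.isEnqR {V : Type} : Event V → Bool
  | .enqR _ => true
  | _ => false

end RTree

namespace RTree

theorem count_enqQ_map_enqR {α : Type} [DecidableEq α] (l : List α) (v : α) :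
    (l.map Event.enqR).count (Event.enqQ v) = 0 := by
  simp [List.count_eq_zero]

variable {V : Type} [Fintype V] [DecidableEq V] (T : RTree V)

/-- `a` is an ancestor of `v`, or `v` itself. -/
def Ancestor (a v : V) : Prop := ∃ k, T.parentIter k v = some a

theorem parentIter_succ' (k : ℕ) (v : V) :
    T.parentIter (k + 1) v = (T.parentIter k v).bind T.parent := by
  induction k generalizing v with
  | zero => cases h : T.parent v <;> simp [parentIter, h]
  | succ k ih =>
    rw [parentIter]
    cases h : T.parent v with
    | none => simp [parentIter, h]
    | some p => simp [parentIter, h, ← ih p]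

theorem depth_of_parentIter {k : ℕ} {a v : V} (h : T.parentIter k v = some a) :
    T.depth v = T.depth a + k := by
  induction k generalizing v with
  | zero => simp_all [parentIter]
  | succ k ih =>
    obtain ⟨p, hp, hk⟩ := Option.bind_eq_some_iff.1 h
    rw [T.depth_parent v p hp, ih hk, add_assoc]

theorem strictAncestor_iff_exists_child {a v : V} :
    T.StrictAncestor a v ↔ ∃ c, T.parent c = some a ∧ T.Ancestor c v := by
  constructor
  · rintro ⟨k, hk, h⟩
    obtain ⟨k, rfl⟩ := Nat.exists_eq_succ_of_ne_zero (Nat.one_le_iff_ne_zero.1 hk)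
    rw [Nat.succ_eq_add_one, parentIter_succ'] at h
    obtain ⟨c, hc, hp⟩ := Option.bind_eq_some_iff.1 h
    exact ⟨c, hp, k, hc⟩
  · rintro ⟨c, hp, k, hc⟩
    exact ⟨k + 1, by lia, by rw [parentIter_succ', hc]; exact hp⟩

theorem ancestor_iff_eq_or_strictAncestor {a v : V} :
    T.Ancestor a v ↔ a = v ∨ T.StrictAncestor a v := by
  constructor
  · rintro ⟨k, h⟩
    cases k with
    | zero => exact Or.inl (Option.some.inj h).symm
    | succ k => exact Or.inr ⟨k + 1, by lia, h⟩
  · rintro (rfl | ⟨k, -, h⟩)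
    · exact ⟨0, rfl⟩
    · exact ⟨k, h⟩

theorem not_strictAncestor_self (v : V) : ¬ T.StrictAncestor v v := by
  rintro ⟨k, hk, h⟩
  have := T.depth_of_parentIter h
  lia

theorem Ancestor.eq_of_depth_eq {a b v : V} (ha : T.Ancestor a v) (hb : T.Ancestor b v)
    (h : T.depth a = T.depth b) : a = b := by
  obtain ⟨k, hk⟩ := ha
  obtain ⟨l, hl⟩ := hb
  have h₁ := T.depth_of_parentIter hk
  have h₂ := T.depth_of_parentIter hl
  obtain rfl : k = l := by lia
  exact Option.some.inj (hk.symm.trans hl)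

theorem ancestor_root (v : V) : T.Ancestor T.root v := by
  induction h : T.depth v generalizing v with
  | zero =>
    by_cases hv : v = T.root
    · exact ⟨0, by rw [hv]; rfl⟩
    · obtain ⟨p, hp⟩ := Option.isSome_iff_exists.1 (T.parent_of_ne v hv)
      have := T.depth_parent v p hp
      lia
  | succ n ih =>
    have hv : v ≠ T.root := by
      rintro rfl
      rw [T.depth_root] at h
      lia
    obtain ⟨p, hp⟩ := Option.isSome_iff_exists.1 (T.parent_of_ne v hv)
    have := T.depth_parent v p hp
    obtain ⟨k, hk⟩ := ih p (by lia)
    exact ⟨k + 1, by simp [parentIter, hp, hk]⟩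

theorem strictAncestor_root_iff {v : V} : T.StrictAncestor T.root v ↔ v ≠ T.root := by
  constructor
  · rintro h rfl
    exact T.not_strictAncestor_self _ h
  · intro h
    exact (T.ancestor_iff_eq_or_strictAncestor.1 (T.ancestor_root v)).resolve_left h.symm

open Classical in
theorem countP_children_ancestor (a v : V) :
    (T.children a).countP (fun c => T.Ancestor c v) = if T.StrictAncestor a v then 1 else 0 := by
  split_ifs with h
  · obtain ⟨c, hc, hcv⟩ := T.strictAncestor_iff_exists_child.1 h
    have hcount : (T.children a).countP (fun c => T.Ancestor c v) = (T.children a).count c := by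
      refine List.countP_congr fun d hd => ?_
      have hd : T.parent d = some a := by simpa [children] using hd
      simp only [decide_eq_true_eq, beq_iff_eq]
      refine ⟨fun hdv => hdv.eq_of_depth_eq T hcv ?_, fun hdc => hdc ▸ hcv⟩
      rw [T.depth_parent d a hd, T.depth_parent c a hc]
    rw [hcount]
    exact List.count_eq_one_of_mem (Finset.nodup_toList _) (by simpa [children] using hc)
  · refine List.countP_eq_zero.2 fun c hc hcv => h ?_
    exact T.strictAncestor_iff_exists_child.2
      ⟨c, by simpa [children] using hc, by simpa using hcv⟩

open Classical in
/-- In a run that empties both queues, a non-inlinable node is enqueued into `q` once for each of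
its ancestors (itself included) in `r` and once for each of its strict ancestors in `q`. -/
theorem count_enqQ_run {v : V} (hv : T.inlinable v = false) (fuel : ℕ) (q r : List V)
    (h : (T.run fuel (q, r)).2 = ([], [])) :
    (T.run fuel (q, r)).1.count (Event.enqQ v) =
      r.countP (fun a => T.Ancestor a v) + q.countP (fun a => T.StrictAncestor a v) := by
  induction fuel generalizing q r with
  | zero => simp_all [run]
  | succ n ih =>
    match q, r with
    | q, f :: r =>
      by_cases hf : T.inlinable f
      · have hne : f ≠ v := by rintro rfl; simp_all
        simp only [run, hf, if_true] at h ⊢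
        simp [List.count_append, count_enqQ_map_enqR, ih _ _ h,
          countP_children_ancestor, List.countP_cons, ancestor_iff_eq_or_strictAncestor T (a := f),
          hne]
      · simp only [run, hf] at h ⊢
        simp [List.count_cons, ih _ _ h, List.countP_cons,
          ancestor_iff_eq_or_strictAncestor T (a := f)]
        by_cases hfv : f = v
        · subst hfv
          simp [not_strictAncestor_self]
          lia
        · simp [hfv]
          lia
    | e :: q, [] =>
      simp only [run] at h ⊢
      simp [List.count_append, count_enqQ_map_enqR, ih _ _ h,
        countP_children_ancestor, List.countP_cons]
      lia
    | [], [] => simp [run]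

theorem inlinable_eq_false_of_enqQ_mem_run {v : V} (fuel : ℕ) (q r : List V)
    (h : Event.enqQ v ∈ (T.run fuel (q, r)).1) : T.inlinable v = false := by
  induction fuel generalizing q r with
  | zero => simp [run] at h
  | succ n ih =>
    match q, r with
    | q, f :: r =>
      by_cases hf : T.inlinable f
      · simp only [run, hf, if_true] at h
        exact ih _ _ (by simpa using h)
      · simp only [run, hf] at h
        have h : v = f ∨ Event.enqQ v ∈ (T.run n (q ++ [f], r)).1 := by simpa using h
        rcases h with rfl | h
        · simpa using hf
        · exact ih _ _ h
    | e :: q, [] =>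
      simp only [run] at h
      exact ih _ _ (by simpa using h)
    | [], [] => simp [run] at h

end RTree

/-- Lemma 4.2: over the entire (terminating) run of the two-queue traversal started
with `q = [root]`, every non-inlinable node is enqueued into `q` exactly once
(counting the initial enqueue of the root), and `q` only ever contains
non-inlinable nodes (every node enqueued into `q` is non-inlinable). -/
theorem xinsert_q_exactly_once
    {V : Type} [Fintype V] [DecidableEq V] (T : RTree V)
    (fuel : ℕ) (tr : List (RTree.Event V))
    (hrun : RTree.run T fuel ([T.root], []) = (tr, ([], []))) :
    (∀ v : V, T.inlinable v = false →
      tr.count (RTree.Event.enqQ v) + (if v = T.root then 1 else 0) = 1) ∧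
    (∀ v : V, 0 < tr.count (RTree.Event.enqQ v) → T.inlinable v = false) := by
  refine ⟨fun v hv => ?_, fun v hv => ?_⟩
  · have h := T.count_enqQ_run hv fuel [T.root] [] (by rw [hrun])
    rw [hrun] at h
    by_cases hr : v = T.root <;> simp_all [T.strictAncestor_root_iff]
  · refine T.inlinable_eq_false_of_enqQ_mem_run fuel [T.root] [] ?_
    rw [hrun]
    exact List.count_pos_iff.1 hv
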